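/- arXiv:2604.28006 — 3 statements merged into one kernel-verified Lean document; each statement's English description precedes it below -/
import Mathlib

section
/- (LDS + short steps or exact line search when gradients are bounded away from zero) Let 𝓜 = argmin_{x∈C} f(x). Assume the Frank–Wolfe iterates are generated either by the short-step rule or by exact line search, that C together with its LMO satisfies local dual sharpness around 𝓜 with constants (A, q), and that G := min_{x∈C} ‖∇f(x)‖ > 0. Then: (1) if q = 2, with κ := (1/2)·min{1, AG/L} there exists t_0 ∈ ℕ such that F_t ≤ (1 − κ)^{t − t_0} F_{t_0} for all t ≥ t_0; (2) if q > 2, there exist t_0 ∈ ℕ and K > 0 such that F_t ≤ K/(t − t_0 + 1)^{q/(q−2)} for all t ≥ t_0. -/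
open scoped RealInnerProductSpace
open Filter

lemma ConvexOn.add_inner_gradient_le {E : Type*} [NormedAddCommGroup E] [InnerProductSpace ℝ E]
    [CompleteSpace E] {f : E → ℝ} (hf : ConvexOn ℝ Set.univ f) {x v : E}
    (hv : HasGradientAt f v x) (y : E) : f x + ⟪v, y - x⟫ ≤ f y := by
  have hconv : ConvexOn ℝ Set.univ (f ∘ AffineMap.lineMap (k := ℝ) x y) := by
    simpa using hf.comp_affineMap (AffineMap.lineMap (k := ℝ) x y)
  have hderiv : HasDerivAt (f ∘ AffineMap.lineMap (k := ℝ) x y) ⟪v, y - x⟫ 0 := by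
    have h1 : HasFDerivAt f (InnerProductSpace.toDual ℝ E v)
        (AffineMap.lineMap (k := ℝ) x y (0 : ℝ)) := by
      simpa using hv.hasFDerivAt
    simpa using h1.comp_hasDerivAt (0 : ℝ) AffineMap.hasDerivAt_lineMap
  have h := hconv.le_slope_of_hasDerivAt (Set.mem_univ 0) (Set.mem_univ 1) one_pos hderiv
  simp [slope_def_field] at h
  linarith

lemma mul_succ_le_one_of_le_mul_one_sub {v : ℕ → ℝ} (hv0 : v 0 ≤ 1)
    (hrec : ∀ n, v (n + 1) ≤ v n * (1 - v n)) (n : ℕ) : (n + 1) * v n ≤ 1 := by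
  induction n with
  | zero => simpa using hv0
  | succ n ih =>
    have hn : (0 : ℝ) ≤ n := n.cast_nonneg
    have h1 : v n ≤ 1 := by by_contra! h; nlinarith
    have h2 := mul_le_mul_of_nonneg_left (hrec n) (by linarith : (0 : ℝ) ≤ n + 2)
    push_cast
    nlinarith [mul_nonneg (sub_nonneg.2 ih) (sub_nonneg.2 h1), sq_nonneg (v n)]

/-- A sublinear rate for sequences with decrease `h n / 2 * min 1 (c * h n ^ p)`. -/
lemma exists_le_div_rpow_of_le_sub_min {h : ℕ → ℝ} {c p : ℝ} (hc : 0 < c) (hp : 0 < p)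
    (hp1 : p ≤ 1) (hh : ∀ n, 0 ≤ h n)
    (hrec : ∀ n, h (n + 1) ≤ h n - h n / 2 * min 1 (c * h n ^ p)) :
    ∃ K > (0 : ℝ), ∀ n : ℕ, h n ≤ K / ((n + 1 : ℕ) : ℝ) ^ (1 / p) := by
  have hanti : Antitone h := antitone_nat_of_succ_le fun n => by
    have h1 : 0 ≤ min 1 (c * h n ^ p) :=
      le_min zero_le_one (mul_nonneg hc.le (Real.rpow_nonneg (hh n) p))
    nlinarith [hrec n, mul_nonneg (hh n) h1]
  set U : ℝ := h 0 ^ p + 1 with hU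
  have hUpos : 0 < U := by have := Real.rpow_nonneg (hh 0) p; positivity
  have huU (n : ℕ) : h n ^ p ≤ U :=
    (Real.rpow_le_rpow (hh n) (hanti n.zero_le) hp.le).trans (by linarith)
  set b : ℝ := min c (1 / U) / 2 with hb
  have hbpos : 0 < b := by positivity
  have hbU (n : ℕ) : b * h n ^ p ≤ 1 / 2 := by
    have h1 : min c (1 / U) * h n ^ p ≤ 1 / U * U :=
      mul_le_mul (min_le_right _ _) (huU n) (Real.rpow_nonneg (hh n) p) (by positivity)
    rw [one_div_mul_cancel hUpos.ne'] at h1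
    rw [hb]; linarith
  have hbc (n : ℕ) : b * h n ^ p ≤ min 1 (c * h n ^ p) / 2 := by
    have h1 : min c (1 / U) * h n ^ p ≤ c * h n ^ p :=
      mul_le_mul_of_nonneg_right (min_le_left _ _) (Real.rpow_nonneg (hh n) p)
    have h2 : 2 * (b * h n ^ p) ≤ min 1 (c * h n ^ p) :=
      le_min (by linarith [hbU n]) (by rw [hb]; linarith)
    linarith
  have hstep (n : ℕ) : h (n + 1) ≤ h n * (1 + -(b * h n ^ p)) := by
    nlinarith [hrec n, mul_le_mul_of_nonneg_left (hbc n) (hh n)]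
  have hustep (n : ℕ) : h (n + 1) ^ p ≤ h n ^ p * (1 - p * b * h n ^ p) := by
    calc h (n + 1) ^ p ≤ (h n * (1 + -(b * h n ^ p))) ^ p :=
          Real.rpow_le_rpow (hh _) (hstep n) hp.le
      _ = h n ^ p * (1 + -(b * h n ^ p)) ^ p :=
          Real.mul_rpow (hh n) (by linarith [hbU n])
      _ ≤ h n ^ p * (1 + p * -(b * h n ^ p)) :=
          mul_le_mul_of_nonneg_left
            (rpow_one_add_le_one_add_mul_self (by linarith [hbU n]) hp.le hp1)
            (Real.rpow_nonneg (hh n) p)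
      _ = _ := by ring
  set a : ℝ := min (p * b) (1 / U) with ha
  have hapos : 0 < a := by positivity
  have hrate (n : ℕ) : (n + 1) * (a * h n ^ p) ≤ 1 := by
    refine mul_succ_le_one_of_le_mul_one_sub (v := fun n => a * h n ^ p) ?_ ?_ n
    · calc a * h 0 ^ p ≤ 1 / U * U :=
            mul_le_mul (min_le_right _ _) (huU 0) (Real.rpow_nonneg (hh 0) p) (by positivity)
        _ = 1 := one_div_mul_cancel hUpos.ne'
    · intro n
      have hu := Real.rpow_nonneg (hh n) p
      calc a * h (n + 1) ^ p ≤ a * (h n ^ p * (1 - p * b * h n ^ p)) :=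
            mul_le_mul_of_nonneg_left (hustep n) hapos.le
        _ ≤ a * (h n ^ p * (1 - a * h n ^ p)) := by
            gcongr
            exact min_le_left _ _
        _ = _ := by ring
  refine ⟨(1 / a) ^ (1 / p), by positivity, fun n => ?_⟩
  have hn : (0 : ℝ) < ((n + 1 : ℕ) : ℝ) := by positivity
  rw [← Real.div_rpow (by positivity) hn.le, one_div p,
    Real.le_rpow_inv_iff_of_pos (hh n) (by positivity) hp, div_div, le_div_iff₀ (by positivity)]
  have := hrate n
  push_cast
  linarith

/-- On a compact set, near-minimizers of a continuous function are close to the minimizers. -/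
lemma IsCompact.exists_infDist_lt_of_sub_lt {X : Type*} [PseudoMetricSpace X] {C : Set X}
    (hC : IsCompact C) {f : X → ℝ} (hf : Continuous f) {m : ℝ} (hm : IsLeast (f '' C) m)
    {ρ : ℝ} (hρ : 0 < ρ) :
    ∃ ε > 0, ∀ x ∈ C, f x - m < ε → Metric.infDist x {y | y ∈ C ∧ f y = m} < ρ := by
  set M : Set X := {y | y ∈ C ∧ f y = m}
  have hK : IsCompact (C ∩ {x | ρ ≤ Metric.infDist x M}) :=
    hC.inter_right (isClosed_le continuous_const (Metric.continuous_infDist_pt M))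
  rcases (C ∩ {x | ρ ≤ Metric.infDist x M}).eq_empty_or_nonempty with h | h
  · refine ⟨1, one_pos, fun x hx _ => not_le.1 fun hle => ?_⟩
    exact Set.eq_empty_iff_forall_notMem.1 h x ⟨hx, hle⟩
  · obtain ⟨z, ⟨hzC, hzρ⟩, hz⟩ := hK.exists_isMinOn h hf.continuousOn
    have hzm : m < f z := by
      refine lt_of_le_of_ne (hm.2 ⟨z, hzC, rfl⟩) fun heq => ?_
      have h0 : Metric.infDist z M = 0 := Metric.infDist_zero_of_mem ⟨hzC, heq.symm⟩
      have : ρ ≤ Metric.infDist z M := hzρ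
      linarith
    refine ⟨f z - m, sub_pos.2 hzm, fun x hx hlt => not_le.1 fun hle => ?_⟩
    have : f z ≤ f x := hz ⟨hx, hle⟩
    linarith

/-- **LDS + short steps or exact line search when gradients are bounded away from zero.**
Under local dual sharpness around the minimizer set with constants `(A,q)` and
`G = min_{x∈C} ‖∇f(x)‖ > 0`: (1) if `q = 2`, then with `κ = (1/2) min{1, AG/L}`
eventually `F_t ≤ (1-κ)^{t-t₀} F_{t₀}`; (2) if `q > 2`, eventually
`F_t ≤ K/(t-t₀+1)^{q/(q-2)}`. -/
theorem lds_lower_bounded_gradients_rates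
    {d : ℕ} {C : Set (EuclideanSpace ℝ (Fin d))}
    (hCne : C.Nonempty) (hCcomp : IsCompact C) (hCconv : Convex ℝ C)
    {f : EuclideanSpace ℝ (Fin d) → ℝ}
    {f' : EuclideanSpace ℝ (Fin d) → EuclideanSpace ℝ (Fin d)}
    (hfconv : ConvexOn ℝ Set.univ f)
    (hgrad : ∀ y, HasGradientAt f (f' y) y)
    {L : ℝ} (hL : 0 < L)
    (hsmooth : ∀ x ∈ C, ∀ y ∈ C,
      f y ≤ f x + ⟪f' x, y - x⟫ + L / 2 * ‖y - x‖ ^ 2)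
    {fstar : ℝ} (hfstar : IsLeast (f '' C) fstar)
    {lmo : EuclideanSpace ℝ (Fin d) → EuclideanSpace ℝ (Fin d)}
    (hlmo : ∀ g, lmo g ∈ C ∧ ∀ y ∈ C, ⟪g, lmo g⟫ ≤ ⟪g, y⟫)
    {A q : ℝ} (hA : 0 < A) (hq : 2 ≤ q)
    (hLDS : ∃ ρ > (0 : ℝ), ∀ x ∈ C,
      Metric.infDist x {y | y ∈ C ∧ f y = fstar} < ρ →
      ∀ g : EuclideanSpace ℝ (Fin d),
        A * ‖g‖ * ‖x - lmo g‖ ^ q ≤ ⟪g, x - lmo g⟫)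
    {G : ℝ} (hGpos : 0 < G)
    (hG : IsLeast ((fun y => ‖f' y‖) '' C) G)
    {x s : ℕ → EuclideanSpace ℝ (Fin d)} {γ : ℕ → ℝ}
    (hx0 : x 0 ∈ C)
    (hs : ∀ t, s t = lmo (f' (x t)))
    (hupd : ∀ t, x (t + 1) = x t + γ t • (s t - x t))
    (hrule :
      (∀ t, γ t =
          min (⟪f' (x t), x t - s t⟫ / (L * ‖x t - s t‖ ^ 2)) 1)
      ∨ (∀ t, γ t ∈ Set.Icc (0 : ℝ) 1 ∧
          ∀ γ' ∈ Set.Icc (0 : ℝ) 1,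
            f (x t + γ t • (s t - x t)) ≤ f (x t + γ' • (s t - x t)))) :
    (q = 2 → ∃ t0 : ℕ, ∀ t : ℕ, t0 ≤ t →
      f (x t) - fstar ≤
        (1 - 1 / 2 * min 1 (A * G / L)) ^ (t - t0) * (f (x t0) - fstar))
    ∧
    (2 < q → ∃ t0 : ℕ, ∃ K > (0 : ℝ), ∀ t : ℕ, t0 ≤ t →
      f (x t) - fstar ≤ K / ((t - t0 + 1 : ℕ) : ℝ) ^ (q / (q - 2))) := by
  set F : ℕ → ℝ := fun t => f (x t) - fstar with hF
  set g : ℕ → ℝ := fun t => ⟪f' (x t), x t - s t⟫ with hg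
  set D : ℕ → ℝ := fun t => ‖x t - s t‖ with hD
  have hsC (t : ℕ) : s t ∈ C := hs t ▸ (hlmo _).1
  have hDnn (t : ℕ) : 0 ≤ D t := norm_nonneg _
  have hγ (t : ℕ) (hxt : x t ∈ C) : γ t ∈ Set.Icc (0 : ℝ) 1 := by
    rcases hrule with h | h
    · rw [h t]
      have h1 : 0 ≤ ⟪f' (x t), x t - s t⟫ := by
        rw [inner_sub_right, sub_nonneg, hs t]
        exact (hlmo _).2 _ hxt
      exact ⟨le_min (by positivity) zero_le_one, min_le_right _ _⟩
    · exact (h t).1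
  have hstepC (t : ℕ) (hxt : x t ∈ C) (η : ℝ) (hη : η ∈ Set.Icc (0 : ℝ) 1) :
      x t + η • (s t - x t) ∈ C :=
    hCconv.add_smul_sub_mem hxt (hsC t) hη
  have hxC (t : ℕ) : x t ∈ C := by
    induction t with
    | zero => exact hx0
    | succ t ih => rw [hupd t]; exact hstepC t ih _ (hγ t ih)
  have hFnn (t : ℕ) : 0 ≤ F t := sub_nonneg.2 (hfstar.2 ⟨x t, hxC t, rfl⟩)
  have hFg (t : ℕ) : F t ≤ g t := by
    obtain ⟨z, hzC, hz⟩ := hfstar.1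
    have h1 := hfconv.add_inner_gradient_le (hgrad (x t)) z
    have h2 := (hlmo (f' (x t))).2 z hzC
    simp only [hF, hg, hs t, inner_sub_right] at h1 ⊢
    linarith
  have hgnn (t : ℕ) : 0 ≤ g t := (hFnn t).trans (hFg t)
  have hquad (t : ℕ) (η : ℝ) (hη : η ∈ Set.Icc (0 : ℝ) 1) :
      f (x t + η • (s t - x t)) ≤ f (x t) - η * g t + L / 2 * (η ^ 2 * D t ^ 2) := by
    have h1 := hsmooth _ (hxC t) _ (hstepC t (hxC t) η hη)
    rw [add_sub_cancel_left, norm_smul, mul_pow, Real.norm_eq_abs, sq_abs, inner_smul_right,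
      norm_sub_rev (s t), ← neg_sub (x t) (s t), inner_neg_right] at h1
    rw [← neg_sub (x t) (s t)]
    simp only [hg, hD]
    linarith
  have hprog (t : ℕ) (m : ℝ) (hm0 : 0 ≤ m) (hm1 : m ≤ 1) (hm : L * D t ^ 2 * m ≤ g t) :
      F (t + 1) ≤ F t - m * g t / 2 := by
    obtain ⟨η, hη, hmη, hηg, hle⟩ : ∃ η ∈ Set.Icc (0 : ℝ) 1, m * g t ≤ η * g t ∧
        L * D t ^ 2 * η ≤ g t ∧ f (x (t + 1)) ≤ f (x t + η • (s t - x t)) := by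
      rcases hrule with h | h
      · refine ⟨γ t, hγ t (hxC t), ?_, ?_, (congrArg f (hupd t)).le⟩
        · rcases (hDnn t).eq_or_lt with h0 | hpos
          · have h1 : x t - s t = 0 := norm_eq_zero.1 h0.symm
            simp [hg, h1]
          · refine mul_le_mul_of_nonneg_right ?_ (hgnn t)
            rw [h t]
            refine le_min ((le_div_iff₀ (by positivity)).2 ?_) hm1
            rw [mul_comm]; exact hm
        · rcases (hDnn t).eq_or_lt with h0 | hpos
          · simpa [← h0] using hgnn t
          · have h1 : γ t ≤ g t / (L * D t ^ 2) := by rw [h t]; exact min_le_left _ _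
            rw [le_div_iff₀ (by positivity)] at h1
            linarith
      · exact ⟨m, ⟨hm0, hm1⟩, le_rfl, hm, by rw [hupd t]; exact (h t).2 m ⟨hm0, hm1⟩⟩
    have h1 := hquad t η hη
    have h2 := mul_le_mul_of_nonneg_left hηg hη.1
    simp only [hF]
    nlinarith
  have hprogF (t : ℕ) (m : ℝ) (hm0 : 0 ≤ m) (hm1 : m ≤ 1) (hm : L * D t ^ 2 * m ≤ g t) :
      F (t + 1) ≤ F t - F t / 2 * m := by
    nlinarith [hprog t m hm0 hm1 hm, mul_le_mul_of_nonneg_left (hFg t) hm0]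
  obtain ⟨R, hRpos, hR⟩ : ∃ R > 0, ∀ t, D t ≤ R := by
    refine ⟨Metric.diam C + 1, by have := Metric.diam_nonneg (s := C); positivity, fun t => ?_⟩
    have := Metric.dist_le_diam_of_mem hCcomp.isBounded (hxC t) (hsC t)
    rw [dist_eq_norm] at this
    simp only [hD]
    linarith
  have hFlim : Tendsto F atTop (nhds 0) := by
    obtain ⟨K, -, hK⟩ := exists_le_div_rpow_of_le_sub_min (h := F) (c := 1 / (L * R ^ 2))
      (p := 1) (by positivity) one_pos le_rfl hFnn fun t => by
        refine hprogF t _ (le_min zero_le_one ?_) (min_le_left _ _) ?_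
        · have := hFnn t
          positivity
        · rw [Real.rpow_one]
          have hFt := hFnn t
          calc L * D t ^ 2 * min 1 (1 / (L * R ^ 2) * F t)
              ≤ L * R ^ 2 * (1 / (L * R ^ 2) * F t) := by
                have := hR t
                have := hDnn t
                gcongr
                exact min_le_right _ _
            _ = F t := by field_simp
            _ ≤ g t := hFg t
    refine squeeze_zero hFnn (g := fun n : ℕ => K / ((n + 1 : ℕ) : ℝ)) (fun n => ?_) ?_
    · simpa using hK n
    · exact (tendsto_const_div_atTop_nhds_zero_nat K).comp (tendsto_add_atTop_nat 1)
  have hfcont : Continuous f :=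
    continuous_iff_continuousAt.2 fun y => (hgrad y).hasFDerivAt.continuousAt
  obtain ⟨ρ, hρ, hLDS⟩ := hLDS
  obtain ⟨ε, hε, hnear⟩ := hCcomp.exists_infDist_lt_of_sub_lt hfcont hfstar hρ
  obtain ⟨t0, ht0⟩ := eventually_atTop.1 (hFlim.eventually (gt_mem_nhds hε))
  have hsharp (t : ℕ) (ht : t0 ≤ t) : A * G * D t ^ q ≤ g t := by
    have h1 := hLDS (x t) (hxC t) (hnear _ (hxC t) (ht0 t ht)) (f' (x t))
    rw [← hs t] at h1
    refine le_trans ?_ h1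
    have h2 : G ≤ ‖f' (x t)‖ := hG.2 ⟨x t, hxC t, rfl⟩
    gcongr
  refine ⟨fun hq2 => ⟨t0, fun t ht => ?_⟩, fun hq2 => ?_⟩
  · have hκ0 : 0 ≤ min 1 (A * G / L) := le_min zero_le_one (by positivity)
    have hκ1 : min 1 (A * G / L) ≤ 1 := min_le_left _ _
    change F t ≤ _ * F t0
    induction t, ht using Nat.le_induction with
    | base => simp
    | succ t ht ih =>
      have h1 := hprogF t _ hκ0 hκ1 <| by
        have h2 := hsharp t ht
        rw [hq2, Real.rpow_two] at h2
        calc L * D t ^ 2 * min 1 (A * G / L) ≤ L * D t ^ 2 * (A * G / L) := by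
              gcongr
              exact min_le_right _ _
          _ = A * G * D t ^ 2 := by field_simp
          _ ≤ g t := h2
      rw [Nat.succ_sub ht, pow_succ]
      have h3 := mul_le_mul_of_nonneg_left ih
        (by linarith : 0 ≤ 1 - 1 / 2 * min 1 (A * G / L))
      linarith
  · have hq0 : 0 < q := by linarith
    have hp : 0 < 1 - 2 / q := by rw [sub_pos, div_lt_one hq0]; exact hq2
    have hp1 : 1 - 2 / q ≤ 1 := sub_le_self _ (by positivity)
    have hexp : q / (q - 2) = 1 / (1 - 2 / q) := by
      have : q - 2 ≠ 0 := by linarith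
      field_simp
    obtain ⟨K, hKpos, hK⟩ := exists_le_div_rpow_of_le_sub_min (h := fun n => F (t0 + n))
      (c := (A * G) ^ (2 / q) / L) (by positivity) hp hp1 (fun n => hFnn _) fun n => by
        have hFn := hFnn (t0 + n)
        have hgn := hgnn (t0 + n)
        have hDn := hDnn (t0 + n)
        refine hprogF (t0 + n) _ (le_min zero_le_one (by positivity)) (min_le_left _ _) ?_
        have h1 : (A * G) ^ (2 / q) * D (t0 + n) ^ 2 ≤ g (t0 + n) ^ (2 / q) := by
          have h2 := Real.rpow_le_rpow (by positivity) (hsharp (t0 + n) (Nat.le_add_right _ _))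
            (by positivity : 0 ≤ 2 / q)
          rwa [Real.mul_rpow (by positivity) (by positivity), ← Real.rpow_mul hDn,
            mul_div_cancel₀ _ hq0.ne', Real.rpow_two] at h2
        calc L * D (t0 + n) ^ 2 * min 1 ((A * G) ^ (2 / q) / L * F (t0 + n) ^ (1 - 2 / q))
            ≤ L * D (t0 + n) ^ 2 * ((A * G) ^ (2 / q) / L * g (t0 + n) ^ (1 - 2 / q)) := by
              refine mul_le_mul_of_nonneg_left ((min_le_right _ _).trans ?_) (by positivity)
              have := hFg (t0 + n)
              gcongr
          _ = (A * G) ^ (2 / q) * D (t0 + n) ^ 2 * g (t0 + n) ^ (1 - 2 / q) := by field_simp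
          _ ≤ g (t0 + n) ^ (2 / q) * g (t0 + n) ^ (1 - 2 / q) := by gcongr
          _ = g (t0 + n) := by
              rw [← Real.rpow_add' hgn (by simp), add_sub_cancel, Real.rpow_one]
    refine ⟨t0, K, hKpos, fun t ht => ?_⟩
    have h1 := hK (t - t0)
    simp only [Nat.add_sub_cancel' ht] at h1
    rw [hexp]
    exact h1
end

section
/- (Beyond 1/t under local dual sharpness for short step and exact line search) Let C be compact and convex and let f : ℝ^d → ℝ be smooth and convex. Suppose C together with its LMO satisfies local dual sharpness around the minimizer set 𝓜 = argmin_{x∈C} f(x) with some constants (A, q). Then the Frank–Wolfe algorithm with either the short-step rule or exact line search satisfies f(x_t) − f* = o(1/t), i.e., t·(f(x_t) − f*) → 0. -/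
open scoped RealInnerProductSpace
open Filter

section FrankWolfe

variable {E : Type*} [NormedAddCommGroup E] [InnerProductSpace ℝ E]

/-- First-order lower bound for a convex function with a gradient. -/
theorem ConvexOn.inner_gradient_le_sub [CompleteSpace E] {f : E → ℝ}
    (hf : ConvexOn ℝ Set.univ f) {x g : E} (hg : HasGradientAt f g x) (y : E) :
    ⟪g, y - x⟫ ≤ f y - f x := by
  have hconv : ConvexOn ℝ Set.univ (f ∘ AffineMap.lineMap (k := ℝ) x y) := by
    simpa using hf.comp_affineMap (AffineMap.lineMap (k := ℝ) x y)
  have hderiv : HasDerivAt (f ∘ AffineMap.lineMap (k := ℝ) x y) ⟪g, y - x⟫ 0 := by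
    have hg' : HasFDerivAt f (InnerProductSpace.toDual ℝ E g)
        (AffineMap.lineMap (k := ℝ) x y 0) := by
      simpa using hg.hasFDerivAt
    simpa using hg'.comp_hasDerivAt (0 : ℝ) AffineMap.hasDerivAt_lineMap
  have := hconv.le_slope_of_hasDerivAt (Set.mem_univ 0) (Set.mem_univ 1) one_pos hderiv
  simpa [slope_def_field] using this

/-- The short step minimizes the quadratic upper model over `γ ≤ 1`. -/
theorem short_step_minimizes_model {L g d γ : ℝ} (hL : 0 < L)
    (hd : d = 0 → g = 0) (hγ : γ ≤ 1) :
    -(min (g / (L * d ^ 2)) 1 * g) + L / 2 * (min (g / (L * d ^ 2)) 1 ^ 2 * d ^ 2) ≤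
      -(γ * g) + L / 2 * (γ ^ 2 * d ^ 2) := by
  rcases eq_or_ne d 0 with rfl | hd₀
  · simp [hd rfl]
  have ha : 0 < L * d ^ 2 := by positivity
  obtain ⟨r, hr⟩ : ∃ r, r = g / (L * d ^ 2) := ⟨_, rfl⟩
  have hgr : g = L * d ^ 2 * r := by rw [hr]; field_simp
  rw [← hr]
  suffices h : -(min r 1 * r) + min r 1 ^ 2 / 2 ≤ -(γ * r) + γ ^ 2 / 2 by
    have := mul_le_mul_of_nonneg_left h ha.le
    rw [hgr]
    linarith
  rcases le_total r 1 with h | h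
  · rw [min_eq_left h]
    nlinarith [sq_nonneg (γ - r)]
  · rw [min_eq_right h]
    nlinarith [mul_nonneg (sub_nonneg.2 hγ) (sub_nonneg.2 h), sq_nonneg (γ - 1)]

/-- A decrease `u (n + 1) ≤ u n - K * u n ^ 2` from index `T` on forces
`u (T + n) ≤ 1 / (K * n)`. -/
theorem mul_mul_le_one_of_quadratic_decrease {u : ℕ → ℝ} {K : ℝ} (hK : 0 < K)
    (hu : ∀ n, 0 ≤ u n) {T : ℕ} (hstep : ∀ n ≥ T, u (n + 1) ≤ u n - K * u n ^ 2) (n : ℕ) :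
    n * (K * u (T + n)) ≤ 1 := by
  induction n with
  | zero => simp
  | succ n ih =>
    have h := mul_le_mul_of_nonneg_left (hstep (T + n) (by omega)) hK.le
    have h₀ := mul_nonneg hK.le (hu (T + n))
    have h₁ := mul_nonneg hK.le (hu (T + n + 1))
    rw [← add_assoc]
    set a := K * u (T + n)
    set b := K * u (T + n + 1)
    have hab : b ≤ a - a ^ 2 := by linarith [show a ^ 2 = K * (K * u (T + n) ^ 2) by ring]
    have ha : a ≤ 1 := by nlinarith
    push_cast
    calc ((n : ℝ) + 1) * b ≤ (n + 1) * (a - a ^ 2) := by gcongr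
      _ = n * a * (1 - a) + a - a ^ 2 := by ring
      _ ≤ 1 := by nlinarith [mul_le_mul_of_nonneg_right ih (sub_nonneg.2 ha)]

/-- A nonnegative sequence that eventually decreases by `K * u n ^ 2`, for every `K`,
is `o(1 / n)`. -/
theorem tendsto_mul_zero_of_quadratic_decrease {u : ℕ → ℝ} (hu : ∀ n, 0 ≤ u n)
    (h : ∀ K > 0, ∀ᶠ n in atTop, u (n + 1) ≤ u n - K * u n ^ 2) :
    Tendsto (fun n : ℕ => (n : ℝ) * u n) atTop (nhds 0) := by
  rw [Metric.tendsto_atTop]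
  intro ε hε
  obtain ⟨T, hT⟩ := eventually_atTop.1 (h (4 / ε) (by positivity))
  refine ⟨2 * T, fun n hn => ?_⟩
  have hn₀ : 0 ≤ (n : ℝ) * u n := mul_nonneg n.cast_nonneg (hu n)
  rw [Real.dist_0_eq_abs, abs_of_nonneg hn₀]
  have key := mul_mul_le_one_of_quadratic_decrease (by positivity) hu hT (n - T)
  rw [Nat.add_sub_cancel' (by omega : T ≤ n), Nat.cast_sub (by omega)] at key
  have hn' : 2 * (T : ℝ) ≤ n := by exact_mod_cast hn
  have key' : ((n : ℝ) - T) * u n * 4 ≤ ε := by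
    have := mul_le_mul_of_nonneg_right key hε.le
    field_simp at this
    linarith
  nlinarith [mul_nonneg (sub_nonneg.2 hn') (hu n)]

/-- A gap bound `R * h ≤ g` turns the quadratic model bound into a decrease `K * h ^ 2`. -/
theorem quadratic_decrease_of_model {h h' g d L K R : ℝ} (hL : 0 < L) (hh : 0 ≤ h) (hK : 0 < K)
    (hR : 0 < R) (hg : R * h ≤ g) (hd : 2 * L * K * d ^ 2 ≤ R ^ 2) (hKR : 2 * K * h ≤ R)
    (hmodel : ∀ γ ∈ Set.Icc (0 : ℝ) 1, h' ≤ h - γ * g + L / 2 * (γ ^ 2 * d ^ 2)) :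
    h' ≤ h - K * h ^ 2 := by
  have hγ₀ : 0 ≤ 2 * K * h / R := by positivity
  have hmod := hmodel (2 * K * h / R) ⟨hγ₀, (div_le_one hR).2 hKR⟩
  have h₁ : 2 * K * h ^ 2 ≤ 2 * K * h / R * g := by
    calc 2 * K * h ^ 2 = 2 * K * h / R * (R * h) := by field_simp
      _ ≤ _ := by gcongr
  have h₂ : L / 2 * ((2 * K * h / R) ^ 2 * d ^ 2) ≤ K * h ^ 2 := by
    calc L / 2 * ((2 * K * h / R) ^ 2 * d ^ 2)
        = K * h ^ 2 / R ^ 2 * (2 * L * K * d ^ 2) := by field_simp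
      _ ≤ K * h ^ 2 / R ^ 2 * R ^ 2 := by gcongr
      _ = K * h ^ 2 := by field_simp
  linarith

/-- On a compact set, near-minimal values force proximity to the minimizer set. -/
theorem IsCompact.exists_infDist_argmin_lt {X : Type*} [PseudoMetricSpace X] {C : Set X}
    (hC : IsCompact C) {f : X → ℝ} (hf : ContinuousOn f C) {m : ℝ} (hm : IsLeast (f '' C) m)
    {η : ℝ} (hη : 0 < η) :
    ∃ ε > 0, ∀ x ∈ C, f x - m < ε → Metric.infDist x {y | y ∈ C ∧ f y = m} < η := by
  set M := {y | y ∈ C ∧ f y = m}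
  have hF : IsCompact (C ∩ {x | η ≤ Metric.infDist x M}) :=
    hC.inter_right (isClosed_le continuous_const (Metric.continuous_infDist_pt M))
  rcases (C ∩ {x | η ≤ Metric.infDist x M}).eq_empty_or_nonempty with he | hne
  · refine ⟨1, one_pos, fun x hx _ => not_le.1 fun h => ?_⟩
    exact he.subset (show x ∈ _ from ⟨hx, h⟩)
  obtain ⟨z, ⟨hzC, hz⟩, hmin⟩ := hF.exists_isMinOn hne (hf.mono Set.inter_subset_left)
  have hzm : m ≠ f z := by
    intro h
    have : Metric.infDist z M = 0 := Metric.infDist_zero_of_mem ⟨hzC, h.symm⟩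
    exact absurd (this ▸ hz : η ≤ 0) (not_le.2 hη)
  refine ⟨f z - m, sub_pos.2 (lt_of_le_of_ne (hm.2 ⟨z, hzC, rfl⟩) hzm),
    fun x hx hlt => not_le.1 fun h => ?_⟩
  have := hmin (show x ∈ _ from ⟨hx, h⟩)
  simp only [Set.mem_ofPred_eq] at this
  linarith

/-- For a convex function, the suboptimality is at most the gradient norm times the distance to
the minimizer set. -/
theorem ConvexOn.sub_le_norm_gradient_mul_infDist [CompleteSpace E] {f : E → ℝ}
    (hf : ConvexOn ℝ Set.univ f) {x g : E} (hg : HasGradientAt f g x) {C : Set E}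
    (hC : IsCompact C) (hfC : Continuous f) {m : ℝ} (hm : m ∈ f '' C) :
    f x - m ≤ ‖g‖ * Metric.infDist x {y | y ∈ C ∧ f y = m} := by
  obtain ⟨z, hz⟩ := hm
  have hM : IsCompact {y | y ∈ C ∧ f y = m} :=
    hC.inter_right (isClosed_eq hfC continuous_const)
  obtain ⟨y, ⟨-, hy⟩, hdist⟩ := hM.exists_infDist_eq_dist ⟨z, hz⟩ x
  have h₁ := hf.inner_gradient_le_sub hg y
  have h₂ := real_inner_le_norm g (x - y)
  rw [hdist, dist_eq_norm]
  rw [← neg_sub x y, inner_neg_right, hy] at h₁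
  linarith

end FrankWolfe

/-- **Beyond 1/t under local dual sharpness for short step and exact line search.**
If `C` together with its LMO satisfies local dual sharpness around the minimizer
set `𝓜` with constants `(A,q)`, then Frank–Wolfe with the short-step rule or
exact line search satisfies `f(x_t) - f* = o(1/t)`. -/
theorem lds_short_step_line_search_little_o
    {d : ℕ} {C : Set (EuclideanSpace ℝ (Fin d))}
    (hCne : C.Nonempty) (hCcomp : IsCompact C) (hCconv : Convex ℝ C)
    {f : EuclideanSpace ℝ (Fin d) → ℝ}
    {f' : EuclideanSpace ℝ (Fin d) → EuclideanSpace ℝ (Fin d)}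
    (hfconv : ConvexOn ℝ Set.univ f)
    (hgrad : ∀ y, HasGradientAt f (f' y) y)
    {L : ℝ} (hL : 0 < L)
    (hsmooth : ∀ x ∈ C, ∀ y ∈ C,
      f y ≤ f x + ⟪f' x, y - x⟫ + L / 2 * ‖y - x‖ ^ 2)
    {fstar : ℝ} (hfstar : IsLeast (f '' C) fstar)
    {lmo : EuclideanSpace ℝ (Fin d) → EuclideanSpace ℝ (Fin d)}
    (hlmo : ∀ g, lmo g ∈ C ∧ ∀ y ∈ C, ⟪g, lmo g⟫ ≤ ⟪g, y⟫)
    {A q : ℝ} (hA : 0 < A) (hq : 2 ≤ q)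
    (hLDS : ∃ ρ > (0 : ℝ), ∀ x ∈ C,
      Metric.infDist x {y | y ∈ C ∧ f y = fstar} < ρ →
      ∀ g : EuclideanSpace ℝ (Fin d),
        A * ‖g‖ * ‖x - lmo g‖ ^ q ≤ ⟪g, x - lmo g⟫)
    {x s : ℕ → EuclideanSpace ℝ (Fin d)} {γ : ℕ → ℝ}
    (hx0 : x 0 ∈ C)
    (hs : ∀ t, s t = lmo (f' (x t)))
    (hupd : ∀ t, x (t + 1) = x t + γ t • (s t - x t))
    (hrule :
      (∀ t, γ t =
          min (⟪f' (x t), x t - s t⟫ / (L * ‖x t - s t‖ ^ 2)) 1)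
      ∨ (∀ t, γ t ∈ Set.Icc (0 : ℝ) 1 ∧
          ∀ γ' ∈ Set.Icc (0 : ℝ) 1,
            f (x t + γ t • (s t - x t)) ≤ f (x t + γ' • (s t - x t)))) :
    Tendsto (fun t : ℕ => (t : ℝ) * (f (x t) - fstar)) atTop (nhds 0) := by
  have hcont : Continuous f := continuous_iff_continuousAt.2 fun y => (hgrad y).continuousAt
  have hsC : ∀ t, s t ∈ C := fun t => hs t ▸ (hlmo _).1
  set g : ℕ → ℝ := fun t => ⟪f' (x t), x t - s t⟫ with hgdef
  set h : ℕ → ℝ := fun t => f (x t) - fstar with hhdef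
  have hgd : ∀ t, ‖x t - s t‖ = 0 → g t = 0 := fun t ht => by
    simp [hgdef, norm_eq_zero.1 ht]
  have hseg : ∀ t, x t ∈ C → ∀ a ∈ Set.Icc (0 : ℝ) 1, x t + a • (s t - x t) ∈ C :=
    fun t hx a ha => hCconv.add_smul_sub_mem hx (hsC t) ha
  have hg₀ : ∀ t, x t ∈ C → 0 ≤ g t := fun t hx => by
    have := (hlmo (f' (x t))).2 _ hx
    rw [← hs] at this
    simpa [hgdef, inner_sub_right] using this
  have hγ : ∀ t, x t ∈ C → γ t ∈ Set.Icc (0 : ℝ) 1 := fun t hx => by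
    rcases hrule with hr | hr
    · rw [hr t]
      have := hg₀ t hx
      exact ⟨le_min (by positivity) zero_le_one, min_le_right _ _⟩
    · exact (hr t).1
  have hxC : ∀ t, x t ∈ C := fun t => by
    induction t with
    | zero => exact hx0
    | succ t ih => exact hupd t ▸ hseg t ih _ (hγ t ih)
  have hh₀ : ∀ t, 0 ≤ h t := fun t => sub_nonneg.2 (hfstar.2 ⟨x t, hxC t, rfl⟩)
  have hupper : ∀ t, ∀ a ∈ Set.Icc (0 : ℝ) 1, f (x t + a • (s t - x t)) ≤
      f (x t) - a * g t + L / 2 * (a ^ 2 * ‖x t - s t‖ ^ 2) := fun t a ha => by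
    have := hsmooth _ (hxC t) _ (hseg t (hxC t) a ha)
    rw [add_sub_cancel_left, inner_smul_right, norm_smul, mul_pow, Real.norm_eq_abs, sq_abs,
      ← neg_sub (x t) (s t), inner_neg_right, norm_neg] at this
    rw [← neg_sub (x t) (s t)]
    linarith
  have hmodel : ∀ t, ∀ a ∈ Set.Icc (0 : ℝ) 1,
      h (t + 1) ≤ h t - a * g t + L / 2 * (a ^ 2 * ‖x t - s t‖ ^ 2) := fun t a ha => by
    simp only [hhdef, hupd t]
    rcases hrule with hr | hr
    · have h₁ := hupper t _ (hγ t (hxC t))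
      have h₂ := short_step_minimizes_model hL (hgd t) ha.2
      rw [← hr t] at h₂
      linarith
    · linarith [(hr t).2 a ha, hupper t a ha]
  have hgap : ∀ t, h t ≤ g t := fun t => by
    obtain ⟨z, hzC, hz⟩ := hfstar.1
    have h₁ := hfconv.inner_gradient_le_sub (hgrad (x t)) z
    have h₂ := (hlmo (f' (x t))).2 z hzC
    rw [← hs] at h₂
    rw [inner_sub_right] at h₁
    simp only [hhdef, hgdef, inner_sub_right]
    linarith
  obtain ⟨D, hD, hdD⟩ : ∃ D > 0, ∀ t, ‖x t - s t‖ ≤ D := by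
    refine ⟨Metric.diam C + 1, by linarith [Metric.diam_nonneg (s := C)], fun t => ?_⟩
    have := Metric.dist_le_diam_of_mem hCcomp.isBounded (hxC t) (hsC t)
    rw [dist_eq_norm] at this
    linarith
  have hdecr : ∀ t, h (t + 1) ≤ h t := fun t => by
    simpa using hmodel t 0 ⟨le_rfl, zero_le_one⟩
  have hh_zero : Tendsto h atTop (nhds 0) := by
    have hanti : Antitone h := antitone_nat_of_succ_le hdecr
    obtain ⟨K, hK, hKD, hKh⟩ : ∃ K > 0, 2 * L * K * D ^ 2 ≤ 1 ∧ 2 * K * h 0 ≤ 1 := by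
      have := hh₀ 0
      have hpos : 0 < 2 * L * D ^ 2 + 2 * h 0 := by positivity
      refine ⟨1 / (2 * L * D ^ 2 + 2 * h 0), by positivity, ?_, ?_⟩
      · field_simp
        linarith
      · field_simp
        nlinarith [mul_pos hL (pow_pos hD 2)]
    have hstep : ∀ t ≥ 0, h (t + 1) ≤ h t - K * h t ^ 2 := fun t _ =>
      quadratic_decrease_of_model hL (hh₀ t) hK one_pos (by linarith [hgap t])
        (by rw [one_pow]; refine le_trans ?_ hKD; gcongr; exact hdD t)
        (by refine le_trans ?_ hKh; gcongr; exact hanti t.zero_le) (hmodel t)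
    refine squeeze_zero' (g := fun n : ℕ => K⁻¹ * (n : ℝ)⁻¹) (.of_forall hh₀) ?_ (by
      simpa using (tendsto_inv_atTop_nhds_zero_nat (𝕜 := ℝ)).const_mul K⁻¹)
    filter_upwards [eventually_gt_atTop 0] with n hn
    have hb := mul_mul_le_one_of_quadratic_decrease hK hh₀ hstep n
    rw [zero_add] at hb
    have hn' : 0 < (n : ℝ) := by exact_mod_cast hn
    rw [← mul_inv, ← one_div, le_div_iff₀ (by positivity)]
    linarith
  refine tendsto_mul_zero_of_quadratic_decrease hh₀ fun K hK => ?_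
  obtain ⟨ρ, hρ, hLDS⟩ := hLDS
  obtain ⟨δ, hδ, hδK⟩ : ∃ δ > 0, 2 * L * K * δ ^ 2 ≤ 1 := by
    refine ⟨√(1 / (2 * L * K)), by positivity, ?_⟩
    rw [Real.sq_sqrt (by positivity)]
    field_simp
    rfl
  set R : ℝ := 2 * L * K * D ^ 2 + 1
  have hR : 1 ≤ R := le_add_of_nonneg_left (by positivity)
  obtain ⟨ε, hε, hclose⟩ := hCcomp.exists_infDist_argmin_lt hcont.continuousOn hfstar
    (show 0 < min ρ (A * δ ^ q / R) by positivity)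
  filter_upwards [hh_zero.eventually_lt_const hε,
    hh_zero.eventually_lt_const (show 0 < 1 / (2 * K) by positivity)] with t htε htK
  have htK' : 2 * K * h t ≤ 1 := by
    rw [lt_div_iff₀ (by positivity)] at htK
    linarith
  rcases le_total ‖x t - s t‖ δ with hd | hd
  · exact quadratic_decrease_of_model hL (hh₀ t) hK one_pos (by linarith [hgap t])
      (by rw [one_pow]; refine le_trans ?_ hδK; gcongr) htK' (hmodel t)
  · have hdist := hclose _ (hxC t) htε
    have hsharp := hLDS _ (hxC t) (hdist.trans_le (min_le_left _ _)) (f' (x t))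
    rw [← hs] at hsharp
    have hsub := hfconv.sub_le_norm_gradient_mul_infDist (hgrad (x t)) hCcomp hcont hfstar.1
    refine quadratic_decrease_of_model hL (hh₀ t) hK (one_pos.trans_le hR) ?_ ?_
      (htK'.trans hR) (hmodel t)
    · calc R * h t ≤ R * (‖f' (x t)‖ * (A * δ ^ q / R)) := by
            gcongr
            exact hsub.trans (by gcongr; exact (hdist.trans_le (min_le_right _ _)).le)
        _ = A * ‖f' (x t)‖ * δ ^ q := by field_simp
        _ ≤ A * ‖f' (x t)‖ * ‖x t - s t‖ ^ q := by gcongr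
        _ ≤ g t := hsharp
    · calc 2 * L * K * ‖x t - s t‖ ^ 2 ≤ 2 * L * K * D ^ 2 := by gcongr; exact hdD t
        _ ≤ R := le_add_of_nonneg_right zero_le_one
        _ ≤ R ^ 2 := le_self_pow₀ hR two_ne_zero
end

section
/- (LDS + open-loop) Assume C is compact and convex, let (x_t) be the Frank–Wolfe iterates generated by the classical open-loop rule γ_t = 2/(t+2), and suppose C together with its LMO satisfies local dual sharpness around the minimizer set 𝓜 = argmin_{x∈C} f(x) with some constants (A, q), q ≥ 2. Then f(x_t) − f* = o(1/t), i.e., t·(f(x_t) − f*) → 0. -/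
open scoped RealInnerProductSpace
open Filter

/-- First-order (gradient) inequality for a differentiable convex function. -/
theorem ConvexOn.add_inner_le_of_hasGradientAt {E : Type*} [NormedAddCommGroup E]
    [InnerProductSpace ℝ E] [CompleteSpace E] {f : E → ℝ} {g x : E}
    (hf : ConvexOn ℝ Set.univ f) (hg : HasGradientAt f g x) (y : E) :
    f x + ⟪g, y - x⟫ ≤ f y := by
  have hline : HasDerivAt (fun r : ℝ => AffineMap.lineMap x y r) (y - x) 0 :=
    AffineMap.hasDerivAt_lineMap
  have hfd : HasFDerivAt f (InnerProductSpace.toDual ℝ E g)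
      (AffineMap.lineMap x y (0 : ℝ)) := by
    simpa using hg.hasFDerivAt
  have hd : HasDerivAt (f ∘ AffineMap.lineMap (k := ℝ) x y) ⟪g, y - x⟫ 0 := by
    simpa using hfd.comp_hasDerivAt (0 : ℝ) hline
  have hc : ConvexOn ℝ Set.univ (f ∘ AffineMap.lineMap (k := ℝ) x y) := by
    simpa using hf.comp_affineMap (AffineMap.lineMap (k := ℝ) x y)
  have h := hc.le_slope_of_hasDerivAt (Set.mem_univ 0) (Set.mem_univ 1) one_pos hd
  simp [slope_def_field] at h
  linarith

/-- A nonnegative sequence grows sublinearly if, for every `ε > 0`, eventually each step either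
increases it by at most `ε`, or by at most a fixed amount from a value that is at most `ε * t`. -/
theorem tendsto_div_of_eventually_small_increment {w : ℕ → ℝ} {K : ℝ} (hw : ∀ t, 0 ≤ w t)
    (hK : 0 ≤ K)
    (hstep : ∀ ε > 0, ∀ᶠ t : ℕ in atTop,
      w (t + 1) ≤ w t + ε ∨ (w t ≤ ε * t ∧ w (t + 1) ≤ w t + K)) :
    Tendsto (fun t : ℕ => w t / ((t : ℝ) + 1)) atTop (nhds 0) := by
  rw [Metric.tendsto_atTop']
  intro ε hε
  obtain ⟨T, hT⟩ := eventually_atTop.1 (hstep (ε / 2) (by positivity))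
  have hlin : ∀ t ≥ T, w t ≤ w T + K + ε / 2 * t := by
    intro t ht
    induction t, ht using Nat.le_induction with
    | base =>
      have : 0 ≤ ε / 2 * (T : ℝ) := by positivity
      linarith
    | succ t ht ih =>
      push_cast
      have := hw T
      rcases hT t ht with h | ⟨h₁, h₂⟩ <;> linarith
  obtain ⟨n, hn⟩ := exists_nat_gt ((w T + K) / (ε / 2))
  rw [div_lt_iff₀ (by positivity)] at hn
  refine ⟨max T n, fun t ht => ?_⟩
  have htT : T ≤ t := (le_max_left T n).trans ht.le
  have htn : (n : ℝ) ≤ t := by exact_mod_cast (le_max_right T n).trans ht.le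
  rw [Real.dist_eq, sub_zero, abs_of_nonneg (div_nonneg (hw t) (by positivity)),
    div_lt_iff₀ (by positivity)]
  have := hlin t htT
  nlinarith

/-- Rescaling `h` by `t * (t + 1)` turns the open-loop Frank–Wolfe recursion with step size
`2 / (t + 2)` into an additive one. -/
theorem openLoop_rescaled_step {h h' G B c : ℝ} (t : ℕ)
    (hrec : h' ≤ h - 2 / ((t : ℝ) + 2) * G + c / 2 * (2 / ((t : ℝ) + 2)) ^ 2 * B)
    (hcB : 0 ≤ c * B) :
    ((t : ℝ) + 1) * (t + 2) * h' ≤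
      t * (t + 1) * h - 2 * (t + 1) * (G - h) + 2 * (c * B) := by
  have ht : (0 : ℝ) < (t : ℝ) + 2 := by positivity
  have hmul := mul_le_mul_of_nonneg_left hrec
    (show 0 ≤ ((t : ℝ) + 1) * (t + 2) by positivity)
  have hcoef : ((t : ℝ) + 1) / (t + 2) ≤ 1 := (div_le_one ht).2 (by linarith)
  have heq : ((t : ℝ) + 1) * (t + 2) *
        (h - 2 / ((t : ℝ) + 2) * G + c / 2 * (2 / ((t : ℝ) + 2)) ^ 2 * B) =
      t * (t + 1) * h - 2 * (t + 1) * (G - h) + 2 * (c * B) * (((t : ℝ) + 1) / (t + 2)) := by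
    field_simp
    ring
  nlinarith [mul_le_mul_of_nonneg_left hcoef (mul_nonneg zero_le_two hcB)]

/-- The minimizers of a continuous function on a compact set attract minimizing sequences. -/
theorem IsCompact.tendsto_infDist_argmin {E : Type*} [PseudoMetricSpace E] {C : Set E} {f : E → ℝ}
    {m : ℝ} (hC : IsCompact C) (hf : Continuous f) (hm : IsLeast (f '' C) m) {x : ℕ → E}
    (hx : ∀ t, x t ∈ C) (hlim : Tendsto (fun t => f (x t)) atTop (nhds m)) {δ : ℝ} (hδ : 0 < δ) :
    ∀ᶠ t in atTop, Metric.infDist (x t) {y | y ∈ C ∧ f y = m} < δ := by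
  set M : Set E := {y | y ∈ C ∧ f y = m}
  have hcl : IsClosed {y | δ ≤ Metric.infDist y M} :=
    isClosed_le continuous_const (Metric.continuous_infDist_pt M)
  have hfar : IsCompact (C ∩ {y | δ ≤ Metric.infDist y M}) := hC.inter_right hcl
  rcases (C ∩ {y | δ ≤ Metric.infDist y M}).eq_empty_or_nonempty with hempty | hne
  · refine Eventually.of_forall fun t => lt_of_not_ge fun hge => ?_
    exact (Set.eq_empty_iff_forall_notMem.1 hempty) (x t) ⟨hx t, hge⟩
  · obtain ⟨z, ⟨hzC, hzM⟩, hz⟩ := hfar.exists_isMinOn hne hf.continuousOn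
    have hmz : m < f z := by
      refine lt_of_le_of_ne (hm.2 ⟨z, hzC, rfl⟩) fun heq => ?_
      have hzero : Metric.infDist z M = 0 := Metric.infDist_zero_of_mem ⟨hzC, heq.symm⟩
      have hzM' : δ ≤ Metric.infDist z M := hzM
      linarith
    filter_upwards [hlim.eventually (gt_mem_nhds hmz)] with t ht
    by_contra! hge
    exact absurd (hz ⟨hx t, hge⟩) (not_le.2 ht)

/-- The optimality gap of a convex function is at most the gradient norm times the distance
to the minimizers. -/
theorem ConvexOn.sub_le_norm_mul_infDist {E : Type*} [NormedAddCommGroup E]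
    [InnerProductSpace ℝ E] [CompleteSpace E] {f : E → ℝ} {g x : E} {M : Set E} {m : ℝ}
    (hf : ConvexOn ℝ Set.univ f) (hg : HasGradientAt f g x) (hM : IsCompact M)
    (hne : M.Nonempty) (hMm : ∀ y ∈ M, f y = m) :
    f x - m ≤ ‖g‖ * Metric.infDist x M := by
  obtain ⟨z, hzM, hz⟩ := hM.exists_infDist_eq_dist hne x
  have hgrad := hf.add_inner_le_of_hasGradientAt hg z
  have hcs := neg_le_of_abs_le (abs_real_inner_le_norm g (z - x))
  rw [hMm z hzM] at hgrad
  rw [hz, dist_comm, dist_eq_norm]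
  linarith

/-- **LDS + open-loop.**
If `C` together with its LMO satisfies local dual sharpness around the minimizer
set `𝓜` with constants `(A,q)`, `q ≥ 2`, then the Frank–Wolfe iterates generated
by the classical open-loop rule `γ_t = 2/(t+2)` satisfy `f(x_t) - f* = o(1/t)`. -/
theorem lds_open_loop_little_o
    {d : ℕ} {C : Set (EuclideanSpace ℝ (Fin d))}
    (hCne : C.Nonempty) (hCcomp : IsCompact C) (hCconv : Convex ℝ C)
    {f : EuclideanSpace ℝ (Fin d) → ℝ}
    {f' : EuclideanSpace ℝ (Fin d) → EuclideanSpace ℝ (Fin d)}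
    (hfconv : ConvexOn ℝ Set.univ f)
    (hgrad : ∀ y, HasGradientAt f (f' y) y)
    {L : ℝ} (hL : 0 < L)
    (hsmooth : ∀ x ∈ C, ∀ y ∈ C,
      f y ≤ f x + ⟪f' x, y - x⟫ + L / 2 * ‖y - x‖ ^ 2)
    {fstar : ℝ} (hfstar : IsLeast (f '' C) fstar)
    {lmo : EuclideanSpace ℝ (Fin d) → EuclideanSpace ℝ (Fin d)}
    (hlmo : ∀ g, lmo g ∈ C ∧ ∀ y ∈ C, ⟪g, lmo g⟫ ≤ ⟪g, y⟫)
    {A q : ℝ} (hA : 0 < A) (hq : 2 ≤ q)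
    (hLDS : ∃ ρ > (0 : ℝ), ∀ x ∈ C,
      Metric.infDist x {y | y ∈ C ∧ f y = fstar} < ρ →
      ∀ g : EuclideanSpace ℝ (Fin d),
        A * ‖g‖ * ‖x - lmo g‖ ^ q ≤ ⟪g, x - lmo g⟫)
    {x s : ℕ → EuclideanSpace ℝ (Fin d)} {γ : ℕ → ℝ}
    (hx0 : x 0 ∈ C)
    (hs : ∀ t, s t = lmo (f' (x t)))
    (hupd : ∀ t, x (t + 1) = x t + γ t • (s t - x t))
    (hγ : ∀ t, γ t = 2 / ((t : ℝ) + 2)) :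
    Tendsto (fun t : ℕ => (t : ℝ) * (f (x t) - fstar)) atTop (nhds 0) := by
  obtain ⟨ρ, hρ, hLDS⟩ := hLDS
  obtain ⟨xs, hxsC, hxs⟩ := hfstar.1
  have hfcont : Continuous f := continuous_iff_continuousAt.2 fun y => (hgrad y).continuousAt
  have hsC : ∀ t, s t ∈ C := fun t => hs t ▸ (hlmo _).1
  have hγ0 : ∀ t, 0 ≤ γ t := fun t => by rw [hγ]; positivity
  have hγ1 : ∀ t, γ t ≤ 1 := fun t => by
    rw [hγ]
    exact (div_le_one (by positivity)).2 (by linarith [(t.cast_nonneg : (0 : ℝ) ≤ t)])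
  have hxC : ∀ t, x t ∈ C := by
    intro t
    induction t with
    | zero => exact hx0
    | succ t ih => rw [hupd]; exact hCconv.add_smul_sub_mem ih (hsC t) ⟨hγ0 t, hγ1 t⟩
  set h : ℕ → ℝ := fun t => f (x t) - fstar
  set G : ℕ → ℝ := fun t => ⟪f' (x t), x t - s t⟫
  have hh0 : ∀ t, 0 ≤ h t := fun t => sub_nonneg.2 (hfstar.2 ⟨x t, hxC t, rfl⟩)
  have hGh : ∀ t, h t ≤ G t := by
    intro t
    have h₁ := hfconv.add_inner_le_of_hasGradientAt (hgrad (x t)) xs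
    have h₂ := (hlmo (f' (x t))).2 xs hxsC
    rw [← hs] at h₂
    simp only [h, G, inner_sub_right] at h₁ ⊢
    linarith
  have hrec : ∀ t, h (t + 1) ≤
      h t - 2 / ((t : ℝ) + 2) * G t + L / 2 * (2 / ((t : ℝ) + 2)) ^ 2 * ‖x t - s t‖ ^ 2 := by
    intro t
    have h₁ := hsmooth (x t) (hxC t) (x (t + 1)) (hxC (t + 1))
    have h₂ : x (t + 1) - x t = -(γ t • (x t - s t)) := by
      rw [hupd, add_sub_cancel_left, ← smul_neg, neg_sub]
    rw [h₂, inner_neg_right, inner_smul_right, norm_neg, norm_smul, mul_pow, Real.norm_eq_abs,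
      sq_abs, hγ] at h₁
    simp only [h, G]
    linarith
  set w : ℕ → ℝ := fun t => t * ((t : ℝ) + 1) * h t
  have hw : ∀ t, 0 ≤ w t := fun t => mul_nonneg (by positivity) (hh0 t)
  have hwstep : ∀ t, w (t + 1) ≤
      w t - 2 * ((t : ℝ) + 1) * (G t - h t) + 2 * (L * ‖x t - s t‖ ^ 2) := by
    intro t
    have := openLoop_rescaled_step t (hrec t) (by positivity)
    simp only [w]
    push_cast
    linarith
  obtain ⟨D, hD⟩ := Metric.isBounded_iff.1 hCcomp.isBounded
  have hdiam : ∀ t, ‖x t - s t‖ ≤ D := fun t => by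
    rw [← dist_eq_norm]; exact hD (hxC t) (hsC t)
  set K : ℝ := 2 * (L * D ^ 2)
  have hK : 0 ≤ K := by positivity
  have hdiamK : ∀ t, 2 * (L * ‖x t - s t‖ ^ 2) ≤ K := fun t => by
    have := hdiam t
    simp only [K]
    gcongr
  have hwK : ∀ t, w (t + 1) ≤ w t + K := by
    intro t
    have := mul_nonneg (show 0 ≤ 2 * ((t : ℝ) + 1) by positivity) (sub_nonneg.2 (hGh t))
    linarith [hwstep t, hdiamK t]
  have hwlin : ∀ t : ℕ, w t ≤ K * t := by
    intro t
    induction t with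
    | zero => simp [w]
    | succ t ih => push_cast; linarith [hwK t]
  have hhlim : Tendsto h atTop (nhds 0) := by
    have hbound : ∀ᶠ t : ℕ in atTop, h t ≤ K / t := by
      filter_upwards [eventually_gt_atTop 0] with t ht
      have ht' : (0 : ℝ) < t := by exact_mod_cast ht
      rw [le_div_iff₀ ht']
      have h₁ : (t : ℝ) * ((t + 1) * h t) ≤ t * K := by
        have := hwlin t
        simp only [w] at this
        linarith
      linarith [le_of_mul_le_mul_left h₁ ht', hh0 t]
    exact squeeze_zero' (Eventually.of_forall hh0) hbound (tendsto_const_div_atTop_nhds_zero_nat K)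
  have hflim : Tendsto (fun t => f (x t)) atTop (nhds fstar) := by
    simpa [h] using hhlim.add_const fstar
  set M : Set (EuclideanSpace ℝ (Fin d)) := {y | y ∈ C ∧ f y = fstar}
  have hMcomp : IsCompact M := hCcomp.inter_right (isClosed_eq hfcont continuous_const)
  have hgap : ∀ t, h t ≤ ‖f' (x t)‖ * Metric.infDist (x t) M := fun t =>
    hfconv.sub_le_norm_mul_infDist (hgrad (x t)) hMcomp ⟨xs, hxsC, hxs⟩ fun y hy => hy.2
  have hmain : Tendsto (fun t : ℕ => w t / ((t : ℝ) + 1)) atTop (nhds 0) := by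
    refine tendsto_div_of_eventually_small_increment hw hK fun ε hε => ?_
    set η : ℝ := √(ε / (2 * L))
    have hη : 0 < η := Real.sqrt_pos.2 (by positivity)
    have hηsq : 2 * (L * η ^ 2) = ε := by
      rw [Real.sq_sqrt (by positivity)]
      field_simp
    set N : ℝ := 1 + K / (2 * ε)
    have hN : 0 < N := by positivity
    have hc : 0 < A * η ^ q := mul_pos hA (Real.rpow_pos_of_pos hη q)
    filter_upwards [hCcomp.tendsto_infDist_argmin hfcont hfstar hxC hflim hρ,
      hCcomp.tendsto_infDist_argmin hfcont hfstar hxC hflim (div_pos hc hN)] with t htρ htN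
    rcases lt_or_ge (‖x t - s t‖) η with hlt | hge
    · left
      have h₁ := mul_nonneg (show 0 ≤ 2 * ((t : ℝ) + 1) by positivity) (sub_nonneg.2 (hGh t))
      have h₂ : 2 * (L * ‖x t - s t‖ ^ 2) ≤ 2 * (L * η ^ 2) := by gcongr
      linarith [hwstep t]
    · have hGN : N * h t ≤ G t := by
        have h₁ := hLDS (x t) (hxC t) htρ (f' (x t))
        rw [← hs] at h₁
        have h₂ : A * ‖f' (x t)‖ * η ^ q ≤ A * ‖f' (x t)‖ * ‖x t - s t‖ ^ q := by
          gcongr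
        have h₃ : Metric.infDist (x t) M * N ≤ A * η ^ q := ((lt_div_iff₀ hN).1 htN).le
        calc N * h t ≤ N * (‖f' (x t)‖ * Metric.infDist (x t) M) := by
              gcongr
              exact hgap t
          _ = ‖f' (x t)‖ * (Metric.infDist (x t) M * N) := by ring
          _ ≤ ‖f' (x t)‖ * (A * η ^ q) := by gcongr
          _ = A * ‖f' (x t)‖ * η ^ q := by ring
          _ ≤ G t := h₂.trans h₁
      have hdec : K / ε * ((t + 1) * h t) ≤ 2 * ((t : ℝ) + 1) * (G t - h t) := by
        have h₁ : K / (2 * ε) * h t ≤ G t - h t := by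
          simp only [N] at hGN
          linarith
        calc K / ε * ((t + 1) * h t) = 2 * ((t : ℝ) + 1) * (K / (2 * ε) * h t) := by
              field_simp
          _ ≤ _ := by gcongr
      rcases le_total (((t : ℝ) + 1) * h t) ε with hsmall | hlarge
      · right
        refine ⟨?_, hwK t⟩
        calc w t = t * ((t + 1) * h t) := by simp only [w]; ring
          _ ≤ t * ε := by gcongr
          _ = ε * t := mul_comm _ _
      · left
        have h₁ : K ≤ K / ε * ((t + 1) * h t) := by
          calc K = K / ε * ε := by field_simp
            _ ≤ _ := by gcongr
        linarith [hwstep t, hdiamK t]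
  refine hmain.congr fun t => ?_
  simp only [w, h]
  field_simp
end
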